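/- Let α ∈ ℝ, let J be a finite set, q : J → ℝ positive, and y : Finset J → ℝ nonnegative with Σ_f y_f = 1; set L := Σ_f y_f · q(f) where q(f) := Σ_{j ∈ f} q_j, and assume L < 4. For a finite multiset g of positive reals, let v_0(g), v_1(g), v_2(g) denote the sum of the elements of g lying in [1,2), [2,4), [4,8) respectively, let Σg denote its sum and Σ_{a∈g} a² the sum of squares of its elements. Suppose that for every finitely supported nonnegative function y' on finite multisets of positive reals with Σ_g y'_g = 1 and Σ_g y'_g (Σg) = L, one has Σ_g y'_g·((1 − α/2)·Σ_{a∈g} a² − (α/2)·(Σg)²) + ½L² − ½·((min(V_0, 1))² + (min(V_1, 2))² + V_2²) ≤ 0, where V_k := Σ_g y'_g v_k(g) for k ∈ {0,1,2}. Then Q + ½L² − ½S ≤ α · ½ · (Q + F), where z_j := Σ_{f ∋ j} y_f, Q := Σ_j z_j q_j², F := Σ_f y_f q(f)², and S := Σ_{k ∈ ℤ} ( min( Σ_{j : 2^k ≤ q_j < 2^{k+1}} z_j q_j , 2^k ) )². -/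

import Mathlib

open scoped Classical

/-- Sum of the elements of the size-configuration `g` lying in `[1, 2)`. -/
noncomputable def vzero (g : Multiset ℝ) : ℝ := (g.filter (fun a => 1 ≤ a ∧ a < 2)).sum

/-- Sum of the elements of the size-configuration `g` lying in `[2, 4)`. -/
noncomputable def vone (g : Multiset ℝ) : ℝ := (g.filter (fun a => 2 ≤ a ∧ a < 4)).sum

/-- Sum of the elements of the size-configuration `g` lying in `[4, 8)`. -/
noncomputable def vtwo (g : Multiset ℝ) : ℝ := (g.filter (fun a => 4 ≤ a ∧ a < 8)).sum

/-- Sum of the squares of the elements of `g`. -/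
noncomputable def sumSq (g : Multiset ℝ) : ℝ := (g.map (fun a => a ^ 2)).sum

/-- The finitely supported weight on size-configurations induced by a weight on job sets. -/
noncomputable def sizeWeight {J : Type*} [Fintype J] (q : J → ℝ) (y : Finset J → ℝ) :
    Multiset ℝ →₀ ℝ :=
  ∑ f, Finsupp.single (f.val.map q) (y f)

theorem sum_sizeWeight_mul {J : Type*} [Fintype J] (q : J → ℝ) (y : Finset J → ℝ)
    (φ : Multiset ℝ → ℝ) :
    ∑ g ∈ (sizeWeight q y).support, sizeWeight q y g * φ g = ∑ f, y f * φ (f.val.map q) := by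
  have h := Finsupp.sum_finsetSum_index (s := Finset.univ)
    (g := fun f : Finset J => Finsupp.single (f.val.map q) (y f))
    (h := fun g c => c * φ g) (fun _ => zero_mul _) (fun _ _ _ => add_mul _ _ _)
  exact h.symm.trans (Finset.sum_congr rfl fun _ _ => Finsupp.sum_single_index (zero_mul _))

theorem sizeWeight_nonneg {J : Type*} [Fintype J] (q : J → ℝ) {y : Finset J → ℝ}
    (hy : ∀ f, 0 ≤ y f) (g : Multiset ℝ) : 0 ≤ sizeWeight q y g := by
  rw [sizeWeight, Finsupp.finsetSum_apply]
  refine Finset.sum_nonneg fun f _ => ?_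
  rw [Finsupp.single_apply]
  split_ifs
  exacts [hy f, le_rfl]

theorem exists_of_mem_support_sizeWeight {J : Type*} [Fintype J] {q : J → ℝ}
    {y : Finset J → ℝ} {g : Multiset ℝ} (hg : g ∈ (sizeWeight q y).support) :
    ∃ f : Finset J, f.val.map q = g := by
  by_contra! h
  refine Finsupp.mem_support_iff.1 hg ?_
  rw [sizeWeight, Finsupp.finsetSum_apply]
  exact Finset.sum_eq_zero fun f _ => Finsupp.single_eq_of_ne' (h f)

/-- Double counting of pairs of a job set and one of its members. -/
theorem sum_mul_sum_eq {J : Type*} [Fintype J] [DecidableEq J] (y : Finset J → ℝ) (w : J → ℝ) :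
    ∑ f, y f * ∑ j ∈ f, w j =
      ∑ j, (∑ f ∈ Finset.univ.filter (fun f => j ∈ f), y f) * w j := by
  simp_rw [Finset.mul_sum, Finset.sum_mul]
  exact Finset.sum_comm' (by simp)

theorem sum_filter_map_val {J : Type*} (q : J → ℝ) (f : Finset J) (p : ℝ → Prop)
    [DecidablePred p] :
    ((f.val.map q).filter p).sum = ∑ j ∈ f, if p (q j) then q j else 0 := by
  rw [Multiset.filter_map, ← Finset.sum_filter]
  rfl

theorem sum_mul_filter_sum_eq {J : Type*} [Fintype J] [DecidableEq J] (q : J → ℝ)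
    (y : Finset J → ℝ) (p : ℝ → Prop) [DecidablePred p] :
    ∑ f, y f * ((f.val.map q).filter p).sum =
      ∑ j ∈ Finset.univ.filter (fun j => p (q j)),
        (∑ f ∈ Finset.univ.filter (fun f => j ∈ f), y f) * q j := by
  simp_rw [sum_filter_map_val, sum_mul_sum_eq, mul_ite, mul_zero]
  rw [Finset.sum_filter]

/-- Only finitely many dyadic classes are occupied. -/
theorem summable_dyadic {J : Type*} [Fintype J] {q : J → ℝ} (hq : ∀ j, 0 < q j) (w : J → ℝ) :
    Summable fun k : ℤ =>
      (min (∑ j ∈ Finset.univ.filter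
          (fun j => (2:ℝ) ^ k ≤ q j ∧ q j < (2:ℝ) ^ (k + 1)), w j) ((2:ℝ) ^ k)) ^ 2 := by
  refine summable_of_ne_finset_zero (s := Finset.univ.image fun j => Int.log 2 (q j)) ?_
  intro k hk
  rw [Finset.filter_false_of_mem, Finset.sum_empty, min_eq_left (by positivity),
    zero_pow two_ne_zero]
  rintro j - ⟨h1, h2⟩
  refine hk (Finset.mem_image.2 ⟨j, Finset.mem_univ j, le_antisymm ?_ ?_⟩)
  · exact Int.lt_add_one_iff.1 ((Int.lt_zpow_iff_log_lt one_lt_two (hq j)).1 (mod_cast h2))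
  · exact (Int.zpow_le_iff_le_log one_lt_two (hq j)).1 (mod_cast h1)

theorem stmt9 (α : ℝ) {J : Type*} [Fintype J] [DecidableEq J]
    (q : J → ℝ) (hq : ∀ j, 0 < q j)
    (y : Finset J → ℝ) (hy : ∀ f, 0 ≤ y f) (hy1 : ∑ f, y f = 1)
    (L : ℝ) (hL : L = ∑ f, y f * ∑ j ∈ f, q j) (hL4 : L < 4)
    (hprog : ∀ y' : Multiset ℝ →₀ ℝ,
      (∀ g, 0 ≤ y' g) →
      (∀ g ∈ y'.support, ∀ a ∈ g, (0:ℝ) < a) →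
      (∑ g ∈ y'.support, y' g) = 1 →
      (∑ g ∈ y'.support, y' g * g.sum) = L →
      (∑ g ∈ y'.support, y' g * ((1 - α / 2) * sumSq g - α / 2 * g.sum ^ 2)) +
          1 / 2 * L ^ 2 -
          1 / 2 * ((min (∑ g ∈ y'.support, y' g * vzero g) 1) ^ 2 +
            (min (∑ g ∈ y'.support, y' g * vone g) 2) ^ 2 +
            (∑ g ∈ y'.support, y' g * vtwo g) ^ 2) ≤ 0)
    (z : J → ℝ) (hz : ∀ j, z j = ∑ f ∈ Finset.univ.filter (fun f => j ∈ f), y f)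
    (Q F S : ℝ)
    (hQ : Q = ∑ j, z j * q j ^ 2)
    (hF : F = ∑ f, y f * (∑ j ∈ f, q j) ^ 2)
    (hS : S = ∑' k : ℤ,
      (min (∑ j ∈ Finset.univ.filter
          (fun j => (2:ℝ) ^ k ≤ q j ∧ q j < (2:ℝ) ^ (k + 1)), z j * q j)
        ((2:ℝ) ^ k)) ^ 2) :
    Q + 1 / 2 * L ^ 2 - 1 / 2 * S ≤ α * (1 / 2) * (Q + F) := by
  have hL' : L = ∑ j, z j * q j := by
    rw [hL, sum_mul_sum_eq]
    simp_rw [hz]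
  have hz0 : ∀ j, 0 ≤ z j := fun j => hz j ▸ Finset.sum_nonneg fun f _ => hy f
  have hzq : ∀ j, 0 ≤ z j * q j := fun j => mul_nonneg (hz0 j) (hq j).le
  have key := hprog (sizeWeight q y) (sizeWeight_nonneg q hy) ?_ ?_ ?_
  · simp_rw [sum_sizeWeight_mul, vzero, vone, vtwo, sum_mul_filter_sum_eq, ← hz] at key
    have hobj : ∑ f, y f * ((1 - α / 2) * sumSq (f.val.map q) - α / 2 * (f.val.map q).sum ^ 2) =
        (1 - α / 2) * Q - α / 2 * F := by
      have hQ' : Q = ∑ f, y f * ∑ j ∈ f, q j ^ 2 := by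
        rw [hQ, sum_mul_sum_eq]
        simp_rw [hz]
      rw [hQ', hF, Finset.mul_sum, Finset.mul_sum, ← Finset.sum_sub_distrib]
      refine Finset.sum_congr rfl fun f _ => ?_
      have hsq : sumSq (f.val.map q) = ∑ j ∈ f, q j ^ 2 := by
        rw [sumSq, Multiset.map_map]
        rfl
      have hsum : (f.val.map q).sum = ∑ j ∈ f, q j := rfl
      rw [hsq, hsum]
      ring
    rw [hobj] at key
    have hS3 := (summable_dyadic hq fun j => z j * q j).sum_le_tsum {0, 1, 2}
      (fun _ _ => sq_nonneg _)
    rw [← hS, Finset.sum_insert (by decide), Finset.sum_insert (by decide),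
      Finset.sum_singleton] at hS3
    norm_num at hS3
    have hV2 : ∑ j with 4 ≤ q j ∧ q j < 8, z j * q j ≤ 4 :=
      calc _ ≤ ∑ j, z j * q j :=
            Finset.sum_le_sum_of_subset_of_nonneg (Finset.filter_subset _ _) fun j _ _ => hzq j
        _ ≤ 4 := hL' ▸ hL4.le
    rw [min_eq_left hV2] at hS3
    linarith
  · intro g hg a ha
    obtain ⟨f, rfl⟩ := exists_of_mem_support_sizeWeight hg
    obtain ⟨j, -, rfl⟩ := Multiset.mem_map.1 ha
    exact hq j
  · simpa [hy1] using sum_sizeWeight_mul q y fun _ => 1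
  · rw [sum_sizeWeight_mul, hL]
    rfl
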